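/- Let ν be the n-fold product of the standard centered Laplace measure on ℝ, and let R ∈ ℝ^{n×n} be invertible. If the pushforward of ν under the linear map x ↦ R x is again a product of centered Laplace measures on ℝ (with some scales s_1, …, s_n > 0 for the coordinates), then R = P D for some permutation matrix P and some invertible diagonal matrix D. Hence, unlike the Gaussian case, product-form Laplace innovations are preserved only by permutations combined with component-wise scalings. -/

import Mathlib

open Matrix MeasureTheory Real

/-- The centered Laplace probability measure on `ℝ` with scale `s > 0`, given by its
Lebesgue density `x ↦ (2s)⁻¹ exp(-|x|/s)`. -/
noncomputable def laplaceMeasure (s : ℝ) : Measure ℝ :=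
  volume.withDensity fun x => ENNReal.ofReal ((2 * s)⁻¹ * Real.exp (-|x| / s))

/-- **Tonelli's theorem** for a product of nonnegative functions of the separate coordinates. -/
theorem lintegral_fin_prod_eq_prod_lintegral {n : ℕ} {E : Fin n → Type*}
    {mE : ∀ i, MeasurableSpace (E i)} {μ : (i : Fin n) → Measure (E i)} [∀ i, SigmaFinite (μ i)]
    {f : (i : Fin n) → E i → ENNReal} (hf : ∀ i, Measurable (f i)) :
    ∫⁻ x : (i : Fin n) → E i, ∏ i, f i (x i) ∂(Measure.pi μ) = ∏ i, ∫⁻ x, f i x ∂(μ i) := by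
  induction n with
  | zero => simp
  | succ n ih =>
    have hmeas : Measurable fun y : (i : Fin n) → E i.succ ↦ ∏ i : Fin n, f i.succ (y i) :=
      Finset.measurable_prod _ fun i _ ↦ (hf i.succ).comp (measurable_pi_apply i)
    rw [Fin.prod_univ_succ, ← ih fun i ↦ hf i.succ,
      ← lintegral_prod_mul (hf 0).aemeasurable hmeas.aemeasurable,
      ← ((measurePreserving_piFinSuccAbove μ 0).symm.lintegral_comp_emb
        (MeasurableEquiv.measurableEmbedding _))]
    refine lintegral_congr fun x ↦ ?_
    rw [Fin.prod_univ_succ]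
    rfl

/-- A product of measures with densities has the product density. -/
theorem pi_withDensity_eq_withDensity_prod {n : ℕ} {E : Fin n → Type*}
    {mE : ∀ i, MeasurableSpace (E i)} {μ : (i : Fin n) → Measure (E i)} [∀ i, SigmaFinite (μ i)]
    {f : (i : Fin n) → E i → ENNReal} (hf : ∀ i, Measurable (f i))
    [∀ i, SigmaFinite ((μ i).withDensity (f i))] :
    Measure.pi (fun i ↦ (μ i).withDensity (f i)) =
      (Measure.pi μ).withDensity fun x ↦ ∏ i, f i (x i) := by
  refine Measure.pi_eq fun s hs ↦ ?_
  rw [withDensity_apply _ (MeasurableSet.univ_pi hs), Measure.restrict_pi_pi,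
    lintegral_fin_prod_eq_prod_lintegral hf]
  exact Finset.prod_congr rfl fun i _ ↦ (withDensity_apply _ (hs i)).symm

theorem pi_laplaceMeasure {n : ℕ} {s : Fin n → ℝ} (hs : ∀ i, 0 < s i) :
    Measure.pi (fun i ↦ laplaceMeasure (s i)) =
      (volume : Measure (Fin n → ℝ)).withDensity fun x ↦
        ENNReal.ofReal ((∏ i, (2 * s i)⁻¹) * Real.exp (-∑ i, |x i| / s i)) := by
  have hsigma (i : Fin n) : SigmaFinite ((volume : Measure ℝ).withDensity
      fun x ↦ ENNReal.ofReal ((2 * s i)⁻¹ * Real.exp (-|x| / s i))) :=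
    SigmaFinite.withDensity_ofReal _
  simp only [laplaceMeasure]
  rw [pi_withDensity_eq_withDensity_prod fun i ↦ by fun_prop, ← volume_pi]
  congr with x
  rw [← ENNReal.ofReal_prod_of_nonneg fun i _ ↦ by have := hs i; positivity,
    Finset.prod_mul_distrib, ← Real.exp_sum, ← Finset.sum_neg_distrib]
  simp only [neg_div]

/-- Change of variables: if an invertible matrix pushes the density `f` forward to the density `g`,
then `f` and `g ∘ R` are proportional. -/
theorem smul_eq_comp_mulVec_of_map_withDensity_eq {n : ℕ} {R : Matrix (Fin n) (Fin n) ℝ}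
    (hR : IsUnit R.det) {f g : (Fin n → ℝ) → ENNReal} (hf : Continuous f) (hg : Continuous g)
    (h : (volume.withDensity f).map R.mulVec = volume.withDensity g) (x : Fin n → ℝ) :
    ENNReal.ofReal |R.det⁻¹| * f x = g (R *ᵥ x) := by
  have hRc : Continuous R.mulVec := by fun_prop
  have hmap : (volume : Measure (Fin n → ℝ)).map R.mulVec =
      ENNReal.ofReal |R.det⁻¹| • volume :=
    Real.map_matrix_volume_pi_eq_smul_volume_pi hR.ne_zero
  have hcf : Continuous fun x ↦ ENNReal.ofReal |R.det⁻¹| * f x :=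
    (ENNReal.continuous_const_mul ENNReal.ofReal_ne_top).comp hf
  have hgR : Continuous fun x ↦ g (R *ᵥ x) := hg.comp hRc
  suffices (volume : Measure (Fin n → ℝ)).withDensity (fun x ↦ ENNReal.ofReal |R.det⁻¹| * f x) =
      volume.withDensity fun x ↦ g (R *ᵥ x) from
    congrFun ((hcf.ae_eq_iff_eq volume hgR).1 ((withDensity_eq_iff_of_sigmaFinite
      hcf.measurable.aemeasurable hgR.measurable.aemeasurable).1 this)) x
  ext A hA
  obtain ⟨B, hB, rfl⟩ : ∃ B, MeasurableSet B ∧ R.mulVec ⁻¹' B = A :=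
    ⟨R⁻¹.mulVec ⁻¹' A, (by fun_prop : Continuous R⁻¹.mulVec).measurable hA, by
      ext y
      simp [Matrix.nonsing_inv_mul _ hR]⟩
  have hB' := congrArg (fun μ ↦ μ B) h
  simp only [Measure.map_apply hRc.measurable hB, withDensity_apply _ hB,
    withDensity_apply _ hA] at hB'
  rw [withDensity_apply _ hA, withDensity_apply _ hA,
    lintegral_const_mul _ hf.measurable, hB',
    ← setLIntegral_map hB hg.measurable hRc.measurable, hmap, Measure.restrict_smul,
    lintegral_smul_measure, smul_eq_mul]

theorem sum_abs_eq_of_map_pi_laplaceMeasure_eq {n : ℕ} {R : Matrix (Fin n) (Fin n) ℝ}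
    (hR : IsUnit R.det) {s t : Fin n → ℝ} (hs : ∀ i, 0 < s i) (ht : ∀ i, 0 < t i)
    (h : (Measure.pi fun i ↦ laplaceMeasure (t i)).map R.mulVec
        = Measure.pi fun i ↦ laplaceMeasure (s i)) (x : Fin n → ℝ) :
    ∑ j, |x j| / t j = ∑ i, |(R *ᵥ x) i| / s i := by
  rw [pi_laplaceMeasure hs, pi_laplaceMeasure ht] at h
  have key := smul_eq_comp_mulVec_of_map_withDensity_eq hR
    (ENNReal.continuous_ofReal.comp (by fun_prop)) (ENNReal.continuous_ofReal.comp (by fun_prop)) h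
  have hspos : 0 < ∏ i, (2 * s i)⁻¹ := Finset.prod_pos fun i _ ↦ by have := hs i; positivity
  have htpos : 0 < ∏ i, (2 * t i)⁻¹ := Finset.prod_pos fun i _ ↦ by have := ht i; positivity
  have key' (y : Fin n → ℝ) : |R.det⁻¹| * ((∏ i, (2 * t i)⁻¹) * Real.exp (-∑ i, |y i| / t i)) =
      (∏ i, (2 * s i)⁻¹) * Real.exp (-∑ i, |(R *ᵥ y) i| / s i) := by
    have hy := key y
    rw [Function.comp_apply, ← ENNReal.ofReal_mul (abs_nonneg _)] at hy
    exact (ENNReal.ofReal_eq_ofReal_iff (by positivity) (by positivity)).1 hy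
  have hconst : |R.det⁻¹| * (∏ i, (2 * t i)⁻¹) = ∏ i, (2 * s i)⁻¹ := by simpa using key' 0
  have hx := key' x
  rw [← mul_assoc, hconst] at hx
  exact neg_injective (Real.exp_injective (mul_left_cancel₀ hspos.ne' hx))

theorem mul_eq_zero_of_abs_add_of_abs_sub {a b : ℝ} (h₁ : |a + b| = |a| + |b|)
    (h₂ : |a - b| = |a| + |b|) : a * b = 0 := by
  have h₃ : (a + b) ^ 2 = (a - b) ^ 2 := by rw [sq_eq_sq_iff_abs_eq_abs, h₁, h₂]
  linarith

/-- A linear map carrying one weighted `ℓ¹` norm to another has at most one nonzero entry in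
each row. -/
theorem mul_apply_eq_zero_of_sum_abs_eq {n : ℕ} {R : Matrix (Fin n) (Fin n) ℝ}
    {s t : Fin n → ℝ} (hs : ∀ i, 0 < s i)
    (h : ∀ x : Fin n → ℝ, ∑ j, |x j| / t j = ∑ i, |(R *ᵥ x) i| / s i)
    (i : Fin n) {j k : Fin n} (hjk : j ≠ k) : R i j * R i k = 0 := by
  have hsingle (l : Fin n) : ∑ i, |R i l| / s i = 1 / t l := by
    have := h (Pi.single l 1)
    simp only [mulVec_single_one, col_apply] at this
    rw [← this, Finset.sum_eq_single l] <;> simp +contextual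
  have hpair (ε : ℝ) (hε : |ε| = 1) : |R i j + ε * R i k| = |R i j| + |R i k| := by
    have hle (i : Fin n) : |R i j + ε * R i k| / s i ≤ |R i j| / s i + |R i k| / s i := by
      rw [← add_div]
      refine div_le_div_of_nonneg_right ((abs_add_le _ _).trans_eq ?_) (hs i).le
      rw [abs_mul, hε, one_mul]
    have hsum : ∑ i, |R i j + ε * R i k| / s i = ∑ i, (|R i j| / s i + |R i k| / s i) := by
      have hx := h (Pi.single j 1 + ε • Pi.single k 1)
      simp only [mulVec_add, mulVec_smul, mulVec_single_one, Pi.add_apply, Pi.smul_apply,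
        col_apply, smul_eq_mul] at hx
      rw [← hx, Finset.sum_add_distrib, hsingle, hsingle,
        Finset.sum_eq_add_of_mem j k (Finset.mem_univ _) (Finset.mem_univ _) hjk]
      · simp [hjk, hjk.symm, hε]
      · rintro l - ⟨hlj, hlk⟩
        simp [hlj, hlk]
    have hi := (Finset.sum_eq_sum_iff_of_le fun i _ ↦ hle i).1 hsum i (Finset.mem_univ i)
    rw [← add_div] at hi
    exact (div_left_inj' (hs i).ne').1 hi
  exact mul_eq_zero_of_abs_add_of_abs_sub (by simpa using hpair 1 (by simp))
    (by simpa [sub_eq_add_neg] using hpair (-1) (by simp))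

/-- An invertible matrix with at most one nonzero entry in each row is a permutation matrix times
an invertible diagonal matrix. -/
theorem exists_eq_permMatrix_mul_diagonal {n K : Type*} [Fintype n] [DecidableEq n] [Field K]
    {R : Matrix n n K} (hR : IsUnit R.det)
    (h : ∀ i j k, j ≠ k → R i j * R i k = 0) :
    ∃ (σ : Equiv.Perm n) (d : n → K),
      (∀ i, d i ≠ 0) ∧ R = σ.permMatrix K * Matrix.diagonal d := by
  have hrow (i : n) : ∃ j, R i j ≠ 0 := by
    by_contra! hi
    exact hR.ne_zero (det_eq_zero_of_row_eq_zero i hi)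
  have hcol (j : n) : ∃ i, R i j ≠ 0 := by
    by_contra! hj
    exact hR.ne_zero (det_eq_zero_of_column_eq_zero j hj)
  choose f hf using hrow
  have huniq {i j : n} (hij : R i j ≠ 0) : f i = j := by
    by_contra hne
    exact mul_ne_zero (hf i) hij (h i _ _ hne)
  have hsurj : Function.Surjective f := fun j ↦ (hcol j).imp fun _ ↦ huniq
  let σ : Equiv.Perm n := Equiv.ofBijective f (Finite.injective_iff_bijective.1
    (Finite.injective_iff_surjective.2 hsurj))
  have hσ (i : n) : σ i = f i := rfl
  refine ⟨σ, fun j ↦ R (σ.symm j) j, fun j ↦ ?_, ?_⟩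
  · have := hf (σ.symm j)
    rwa [← hσ, σ.apply_symm_apply] at this
  · ext i j
    rw [mul_diagonal, Equiv.Perm.permMatrix, PEquiv.toMatrix_apply]
    by_cases hij : f i = j
    · subst hij
      simp [← hσ]
    · have : R i j = 0 := by
        by_contra hne
        exact hij (huniq hne)
      simp [hσ, this, hij]

/-- **Product-form Laplace innovations are preserved only by permutations combined with
component-wise scalings.**  Let `ν` be the `n`-fold product of the standard centered
Laplace measure and let `R` be invertible.  If the pushforward of `ν` under `x ↦ R x`
is again a product of centered Laplace measures (with some scales `s i > 0`), then
`R = P D` for some permutation matrix `P` and invertible diagonal matrix `D`. -/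
theorem laplace_product_preserved_only_by_perm_scaling
    {n : ℕ} (R : Matrix (Fin n) (Fin n) ℝ) (hR : IsUnit R.det)
    (h : ∃ s : Fin n → ℝ, (∀ i, 0 < s i) ∧
      (Measure.pi fun _ : Fin n => laplaceMeasure 1).map R.mulVec
        = Measure.pi fun i => laplaceMeasure (s i)) :
    ∃ (σ : Equiv.Perm (Fin n)) (d : Fin n → ℝ),
      (∀ i, d i ≠ 0) ∧ R = σ.permMatrix ℝ * Matrix.diagonal d := by
  obtain ⟨s, hs, h⟩ := h
  exact exists_eq_permMatrix_mul_diagonal hR fun i _ _ ↦ mul_apply_eq_zero_of_sum_abs_eq hs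
    (sum_abs_eq_of_map_pi_laplaceMeasure_eq hR hs (fun _ ↦ one_pos) h) i
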